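/- arXiv:math/9609210 — 2 statements merged into one kernel-verified Lean document; each statement's English description precedes it below -/
import Mathlib

section
/- Star Lemma, part (ii), Euclidean case: let n ≥ 3 and let D ⊊ ℝⁿ be an open connected set containing 0 which is star-like with respect to 0 (for every x ∈ D the segment [0,x] lies in D). Let Δ := { x ∈ ∂D : the half-open segment [0,x) is contained in D }, let ε > 0 with closedBall(0,ε) ⊂ D, and let Γ_ε be the family of all piecewise C¹ curves γ : [0,1] → ℝⁿ with γ(0) ∈ closedBall(0,ε), γ(1) ∈ Δ, and γ([0,1)) ⊂ D. If mod_n Γ_ε = 0, then ∂D does not locally divide ℝⁿ: for every x ∈ ∂D and every neighborhood U of x there exists a neighborhood V of x with V ⊆ U such that V \ ∂D is connected. -/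
open MeasureTheory Metric Set
open scoped ENNReal

/-- A path `γ : [0,1] → ℝⁿ` is piecewise `C¹` if it is continuous on `[0,1]`
and, off a finite set of parameters, differentiable with continuous
derivative. -/
def IsPiecewiseC1 {n : ℕ} (γ : ℝ → EuclideanSpace ℝ (Fin n)) : Prop :=
  ContinuousOn γ (Set.Icc 0 1) ∧
  ∃ s : Finset ℝ, ∀ t ∈ Set.Icc (0 : ℝ) 1, t ∉ s →
    DifferentiableAt ℝ γ t ∧ ContinuousAt (deriv γ) t

/-- The line integral `∫_γ ρ ds = ∫_0^1 ρ(γ(t)) ‖γ′(t)‖ dt` of a Borel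
function `ρ : ℝⁿ → [0,∞]` along a path `γ`. -/
noncomputable def lineLIntegral {n : ℕ} (ρ : EuclideanSpace ℝ (Fin n) → ℝ≥0∞)
    (γ : ℝ → EuclideanSpace ℝ (Fin n)) : ℝ≥0∞ :=
  ∫⁻ t in Set.Icc (0 : ℝ) 1, ρ (γ t) * ENNReal.ofReal ‖deriv γ t‖

/-- The conformal modulus `mod_n Γ` of a family `Γ` of piecewise `C¹` curves
in `ℝⁿ`: the infimum of `∫ ρⁿ dx` over Borel `ρ : ℝⁿ → [0,∞]` with
`∫_γ ρ ds ≥ 1` for every `γ ∈ Γ`. -/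
noncomputable def conformalModulus (n : ℕ)
    (Γ : Set (ℝ → EuclideanSpace ℝ (Fin n))) : ℝ≥0∞ :=
  ⨅ (ρ : EuclideanSpace ℝ (Fin n) → ℝ≥0∞) (_ : Measurable ρ)
    (_ : ∀ γ ∈ Γ, 1 ≤ lineLIntegral ρ γ), ∫⁻ x, ρ x ^ n

/-- The part `Δ` of `∂D` visible from `0`: boundary points `x` such that the
half-open segment `[0,x)` is contained in `D`. -/
def visibleBoundary {n : ℕ} (D : Set (EuclideanSpace ℝ (Fin n))) :
    Set (EuclideanSpace ℝ (Fin n)) :=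
  {x | x ∈ frontier D ∧ ∀ s ∈ Set.Ico (0 : ℝ) 1, s • x ∈ D}

/-- The family `Γ_ε` of piecewise `C¹` curves joining `closedBall 0 ε` to the
visible boundary `Δ` within `D`. -/
def starCurves {n : ℕ} (D : Set (EuclideanSpace ℝ (Fin n))) (ε : ℝ) :
    Set (ℝ → EuclideanSpace ℝ (Fin n)) :=
  {γ | IsPiecewiseC1 γ ∧ γ 0 ∈ closedBall (0 : EuclideanSpace ℝ (Fin n)) ε ∧
    γ 1 ∈ visibleBoundary D ∧ ∀ t ∈ Set.Ico (0 : ℝ) 1, γ t ∈ D}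

/-- An affine substitution `x ↦ c • x + e` carrying `A` into `B`, for nonnegative integrands. -/
theorem setLIntegral_comp_smul_add_le {E : Type*} [NormedAddCommGroup E] [NormedSpace ℝ E]
    [FiniteDimensional ℝ E] [MeasurableSpace E] [BorelSpace E] (μ : Measure E)
    [μ.IsAddHaarMeasure] {f : E → ℝ≥0∞} (hf : Measurable f) {c : ℝ} (hc : 0 < c) (e : E)
    {A B : Set E} (hA : MeasurableSet A) (hB : MeasurableSet B)
    (hAB : ∀ x ∈ A, c • x + e ∈ B) :
    ENNReal.ofReal (c ^ Module.finrank ℝ E) * ∫⁻ x in A, f (c • x + e) ∂μ ≤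
      ∫⁻ x in B, f x ∂μ := by
  have hc' : 0 < c ^ Module.finrank ℝ E := by positivity
  have hBf : Measurable (B.indicator f) := hf.indicator hB
  have h1 : ∫⁻ x in A, f (c • x + e) ∂μ ≤ ∫⁻ x, B.indicator f (c • x + e) ∂μ := by
    rw [← lintegral_indicator hA]
    refine lintegral_mono fun x => ?_
    by_cases hx : x ∈ A
    · simp [hx, hAB x hx]
    · simp [hx]
  have h2 : ∫⁻ x, B.indicator f (c • x + e) ∂μ =
      ENNReal.ofReal (c ^ Module.finrank ℝ E)⁻¹ * ∫⁻ x in B, f x ∂μ := by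
    have h3 := lintegral_map (μ := μ) (f := fun y => B.indicator f (y + e)) (g := fun x => c • x)
      (by fun_prop) (by fun_prop)
    rw [← h3, Measure.map_addHaar_smul μ hc.ne', lintegral_smul_measure,
      lintegral_add_right_eq_self (B.indicator f) e, lintegral_indicator hB,
      abs_of_pos (inv_pos.2 hc'), smul_eq_mul]
  calc _ ≤ ENNReal.ofReal (c ^ Module.finrank ℝ E) *
        (ENNReal.ofReal (c ^ Module.finrank ℝ E)⁻¹ * ∫⁻ x in B, f x ∂μ) := by
        rw [← h2]; gcongr
    _ = _ := by
        rw [← mul_assoc, ← ENNReal.ofReal_mul hc'.le, mul_inv_cancel₀ hc'.ne',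
          ENNReal.ofReal_one, one_mul]

/-- A weighted Young-type inequality: the weight `v` may be put on `xⁿ` at the price of the
additive term `v ^ (-1/2)`, as soon as `n ≥ 3`. -/
theorem le_rpow_add_mul_pow {n : ℕ} (hn : 3 ≤ n) {l v : ℝ} (hl : 0 < l) (hv : 0 < v)
    (hv1 : v ≤ 1) (x : ℝ≥0∞) :
    x ≤ ENNReal.ofReal (l * v ^ (-(1 / 2) : ℝ)) +
      ENNReal.ofReal (l⁻¹ ^ (n - 1)) * (ENNReal.ofReal v * x ^ n) := by
  set h : ℝ := l * v ^ (-(1 / 2) : ℝ) with hh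
  have hpos : 0 < h := by positivity
  rcases le_total x (ENNReal.ofReal h) with hx | hx
  · exact le_add_right hx
  refine le_add_left ?_
  have hinv : h⁻¹ ^ (n - 1) ≤ l⁻¹ ^ (n - 1) * v := by
    rw [hh, mul_inv, Real.rpow_neg hv.le, inv_inv, ← Real.sqrt_eq_rpow, mul_pow]
    gcongr
    calc √v ^ (n - 1) ≤ √v ^ 2 :=
          pow_le_pow_of_le_one (Real.sqrt_nonneg _) (Real.sqrt_le_one.2 hv1) (by omega)
      _ = v := Real.sq_sqrt hv.le
  have hone : 1 ≤ ENNReal.ofReal (h⁻¹) * x := by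
    calc (1 : ℝ≥0∞) = ENNReal.ofReal h⁻¹ * ENNReal.ofReal h := by
          rw [← ENNReal.ofReal_mul (by positivity), inv_mul_cancel₀ hpos.ne', ENNReal.ofReal_one]
      _ ≤ _ := by gcongr
  calc x ≤ (ENNReal.ofReal h⁻¹ * x) ^ (n - 1) * x :=
        le_mul_of_one_le_left (by simp) (one_le_pow₀ hone)
    _ = ENNReal.ofReal (h⁻¹ ^ (n - 1)) * x ^ n := by
        rw [mul_pow, mul_assoc, ← pow_succ, Nat.sub_add_cancel (by omega),
          ENNReal.ofReal_pow (by positivity)]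
    _ ≤ ENNReal.ofReal (l⁻¹ ^ (n - 1) * v) * x ^ n := by gcongr
    _ = _ := by rw [ENNReal.ofReal_mul (by positivity), mul_assoc]

theorem lintegral_one_sub_rpow_neg_half_lt_top :
    ∫⁻ u in Ico (0 : ℝ) 1, ENNReal.ofReal ((1 - u) ^ (-(1 / 2) : ℝ)) < ⊤ := by
  have h := (intervalIntegral.intervalIntegrable_rpow' (a := 0) (b := 1)
    (r := -(1 / 2)) (by norm_num)).comp_sub_left 1
  simp only [sub_zero, sub_self] at h
  replace h := h.symm
  rw [intervalIntegrable_iff_integrableOn_Ico_of_le zero_le_one] at h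
  exact Integrable.lintegral_lt_top h

/-- In the plane, curves ending at a common point have positive `n`-modulus for `n ≥ 3`: here the
family of segments joining the base `{t₀} × [0, s₀]` to an apex `(τ, σ)`, with a bound which
does not depend on the apex. -/
theorem exists_pos_le_lintegral_of_segments {n : ℕ} (hn : 3 ≤ n) {t₀ s₀ C : ℝ} (ht₀ : 0 < t₀)
    (hs₀ : 0 < s₀) (hC : 0 < C) :
    ∃ c : ℝ, 0 < c ∧ ∀ g : ℝ → ℝ → ℝ≥0∞, Measurable (Function.uncurry g) →
      ∀ σ τ : ℝ, s₀ ≤ σ → σ ≤ 1 → 2 * t₀ ≤ τ → τ ≤ 1 →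
      (∀ b ∈ Icc 0 s₀, 1 ≤ ∫⁻ u in Icc (0 : ℝ) 1,
        g (t₀ + u * (τ - t₀)) ((1 - u) * b + u * σ) * ENNReal.ofReal C) →
      ENNReal.ofReal c ≤ ∫⁻ t in Icc t₀ 1, ∫⁻ s in Icc (0 : ℝ) 1, g t s ^ n := by
  set I := ∫⁻ u in Ico (0 : ℝ) 1, ENNReal.ofReal ((1 - u) ^ (-(1 / 2) : ℝ)) with hI
  have hItop : I ≠ ⊤ := lintegral_one_sub_rpow_neg_half_lt_top.ne
  obtain ⟨l, hl, hlI⟩ : ∃ l : ℝ, 0 < l ∧ ENNReal.ofReal (l * C) * I ≤ 2⁻¹ := by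
    refine ⟨1 / (2 * C * (I.toReal + 1)), by positivity, ?_⟩
    rw [← ENNReal.ofReal_toReal hItop, ← ENNReal.ofReal_mul (by positivity),
      show (2⁻¹ : ℝ≥0∞) = ENNReal.ofReal (2⁻¹) by
        rw [ENNReal.ofReal_inv_of_pos two_pos]; simp]
    apply ENNReal.ofReal_le_ofReal
    have : 0 ≤ I.toReal := ENNReal.toReal_nonneg
    rw [ENNReal.toReal_ofReal this]
    field_simp
    linarith
  set K : ℝ := l⁻¹ ^ (n - 1) with hK
  have hKpos : 0 < K := by positivity
  refine ⟨s₀ * t₀ / (2 * C * K), by positivity, fun g hg σ τ hσ hσ1 hτ hτ1 hadm => ?_⟩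
  have hgn : Measurable (Function.uncurry fun t s => g t s ^ n) := hg.pow_const n
  have hline : ∀ b ∈ Icc 0 s₀, 2⁻¹ ≤ ENNReal.ofReal (C * K) * ∫⁻ u in Ico (0 : ℝ) 1,
      ENNReal.ofReal (1 - u) * g (t₀ + u * (τ - t₀)) ((1 - u) * b + u * σ) ^ n := by
    intro b hb
    have hmeas : Measurable fun u : ℝ =>
        ENNReal.ofReal (1 - u) * g (t₀ + u * (τ - t₀)) ((1 - u) * b + u * σ) ^ n :=
      Measurable.mul (by fun_prop)
        (hgn.comp (g := fun p : ℝ × ℝ => g p.1 p.2 ^ n)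
          (f := fun u : ℝ => (t₀ + u * (τ - t₀), (1 - u) * b + u * σ)) (by fun_prop))
    have h1 := hadm b hb
    rw [← setLIntegral_congr (Ico_ae_eq_Icc (a := (0 : ℝ)) (b := 1))] at h1
    have h2 : (1 : ℝ≥0∞) ≤ 2⁻¹ + ENNReal.ofReal (C * K) * ∫⁻ u in Ico (0 : ℝ) 1,
        ENNReal.ofReal (1 - u) * g (t₀ + u * (τ - t₀)) ((1 - u) * b + u * σ) ^ n := by
      calc (1 : ℝ≥0∞) ≤ _ := h1
        _ ≤ ∫⁻ u in Ico (0 : ℝ) 1,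
            (ENNReal.ofReal (l * C) * ENNReal.ofReal ((1 - u) ^ (-(1 / 2) : ℝ)) +
              ENNReal.ofReal (C * K) * (ENNReal.ofReal (1 - u) *
                g (t₀ + u * (τ - t₀)) ((1 - u) * b + u * σ) ^ n)) := by
            refine setLIntegral_mono (by fun_prop) fun u hu => ?_
            have h3 := le_rpow_add_mul_pow hn hl (v := 1 - u) (by linarith [hu.2])
              (by linarith [hu.1]) (g (t₀ + u * (τ - t₀)) ((1 - u) * b + u * σ))
            refine (mul_le_mul_left h3 _).trans_eq ?_
            rw [ENNReal.ofReal_mul hl.le, ENNReal.ofReal_mul hl.le, ENNReal.ofReal_mul hC.le]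
            ring
        _ = ENNReal.ofReal (l * C) * I + _ := by
            rw [lintegral_add_left (by fun_prop), lintegral_const_mul _ (by fun_prop),
              lintegral_const_mul _ hmeas]
        _ ≤ _ := by gcongr
    rw [← ENNReal.inv_two_add_inv_two] at h2
    exact (ENNReal.add_le_add_iff_left (by simp)).1 h2
  have hτt : 0 < τ - t₀ := by linarith
  have hinner : Measurable fun t => ∫⁻ s in Icc (0 : ℝ) 1, g t s ^ n :=
    hgn.lintegral_prod_right'
  have hjoint : Measurable (Function.uncurry fun b u : ℝ => ENNReal.ofReal (1 - u) *
      g (t₀ + u * (τ - t₀)) ((1 - u) * b + u * σ) ^ n) :=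
    Measurable.mul (f := fun p : ℝ × ℝ => ENNReal.ofReal (1 - p.2)) (by fun_prop)
      (hgn.comp (g := fun p : ℝ × ℝ => g p.1 p.2 ^ n)
        (f := fun p : ℝ × ℝ => (t₀ + p.2 * (τ - t₀), (1 - p.2) * p.1 + p.2 * σ)) (by fun_prop))
  set T := ∫⁻ t in Icc t₀ 1, ∫⁻ s in Icc (0 : ℝ) 1, g t s ^ n with hT
  have hsub : ENNReal.ofReal t₀ * ∫⁻ b in Icc 0 s₀, ∫⁻ u in Ico (0 : ℝ) 1,
      ENNReal.ofReal (1 - u) * g (t₀ + u * (τ - t₀)) ((1 - u) * b + u * σ) ^ n ≤ T := by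
    rw [lintegral_lintegral_swap hjoint.aemeasurable]
    have hb : ∀ u ∈ Ico (0 : ℝ) 1, ∫⁻ b in Icc 0 s₀, ENNReal.ofReal (1 - u) *
        g (t₀ + u * (τ - t₀)) ((1 - u) * b + u * σ) ^ n ≤
        ∫⁻ s in Icc (0 : ℝ) 1, g ((τ - t₀) * u + t₀) s ^ n := by
      intro u hu
      have hu1 : 0 < 1 - u := by linarith [hu.2]
      have := setLIntegral_comp_smul_add_le volume
        (f := fun s => g ((τ - t₀) * u + t₀) s ^ n)
        (hgn.comp (g := fun p : ℝ × ℝ => g p.1 p.2 ^ n)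
          (f := fun s : ℝ => ((τ - t₀) * u + t₀, s)) (by fun_prop))
        hu1 (u * σ) (A := Icc 0 s₀) (B := Icc 0 1) measurableSet_Icc measurableSet_Icc
        (fun b hb => by
          simp only [smul_eq_mul]
          have h0 : b ≤ 1 := by linarith [hb.2]
          have h1 : 0 ≤ (1 - u) * b := mul_nonneg hu1.le hb.1
          have h2 : 0 ≤ u * σ := mul_nonneg hu.1 (by linarith)
          refine ⟨by linarith, ?_⟩
          nlinarith [hu.1])
      rw [← lintegral_const_mul' _ _ (by simp)] at this
      simpa [mul_comm, add_comm] using this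
    have hu := setLIntegral_comp_smul_add_le volume hinner hτt t₀ (A := Ico 0 1)
      (B := Icc t₀ 1) measurableSet_Ico measurableSet_Icc (fun u hu => by
        simp only [smul_eq_mul]
        have := mul_nonneg hτt.le hu.1
        refine ⟨by linarith, ?_⟩
        nlinarith [hu.2])
    refine le_trans ?_ hu
    simp only [Module.finrank_self, pow_one, smul_eq_mul]
    exact mul_le_mul' (ENNReal.ofReal_le_ofReal (by linarith))
      (setLIntegral_mono (hinner.comp (by fun_prop)) hb)
  have hbase : ENNReal.ofReal s₀ * 2⁻¹ ≤ ENNReal.ofReal (C * K) *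
      ∫⁻ b in Icc 0 s₀, ∫⁻ u in Ico (0 : ℝ) 1,
        ENNReal.ofReal (1 - u) * g (t₀ + u * (τ - t₀)) ((1 - u) * b + u * σ) ^ n := by
    rw [← lintegral_const_mul' _ _ (by simp)]
    calc ENNReal.ofReal s₀ * 2⁻¹ = ∫⁻ _ in Icc 0 s₀, (2⁻¹ : ℝ≥0∞) := by
          simp [mul_comm]
      _ ≤ _ := setLIntegral_mono' measurableSet_Icc hline
  have hfin : ENNReal.ofReal (s₀ * t₀ / 2) ≤ ENNReal.ofReal (C * K) * T := by
    calc ENNReal.ofReal (s₀ * t₀ / 2) = ENNReal.ofReal t₀ * (ENNReal.ofReal s₀ * 2⁻¹) := by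
          rw [div_eq_mul_inv, ENNReal.ofReal_mul (by positivity), ENNReal.ofReal_mul hs₀.le,
            ENNReal.ofReal_inv_of_pos two_pos]
          simp only [ENNReal.ofReal_ofNat]
          ring
      _ ≤ _ := by
          refine (mul_le_mul_right hbase _).trans ?_
          rw [mul_left_comm]
          gcongr
  have hCK : 0 < C * K := by positivity
  calc ENNReal.ofReal (s₀ * t₀ / (2 * C * K))
      = ENNReal.ofReal (C * K)⁻¹ * ENNReal.ofReal (s₀ * t₀ / 2) := by
        rw [← ENNReal.ofReal_mul (by positivity)]
        congr 1
        field_simp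
    _ ≤ ENNReal.ofReal (C * K)⁻¹ * (ENNReal.ofReal (C * K) * T) := by gcongr
    _ = T := by
        rw [← mul_assoc, ← ENNReal.ofReal_mul (by positivity), inv_mul_cancel₀ hCK.ne',
          ENNReal.ofReal_one, one_mul]

/-- Averaging over translations `w`, the integral of `f` over the planar fans
`(t, s) ↦ t • (P + w + s • d)` is controlled by the integral of `f` over the whole space. -/
theorem lintegral_fan_le {E : Type*} [NormedAddCommGroup E] [NormedSpace ℝ E]
    [FiniteDimensional ℝ E] [MeasurableSpace E] [BorelSpace E] (μ : Measure E)
    [μ.IsAddHaarMeasure] {f : E → ℝ≥0∞} (hf : Measurable f) {t₀ : ℝ} (ht₀ : 0 < t₀) (P d : E)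
    {A : Set E} (hA : MeasurableSet A) :
    ENNReal.ofReal (t₀ ^ Module.finrank ℝ E) *
      ∫⁻ w in A, (∫⁻ t in Icc t₀ 1, ∫⁻ s in Icc (0 : ℝ) 1, f (t • (P + w + s • d))) ∂μ ≤
      ∫⁻ x, f x ∂μ := by
  have hm : Measurable fun p : (E × ℝ) × ℝ => f (p.1.2 • (P + p.1.1 + p.2 • d)) :=
    hf.comp (by fun_prop)
  have hms : Measurable fun p : E × ℝ => ∫⁻ s in Icc (0 : ℝ) 1, f (p.2 • (P + p.1 + s • d)) :=
    hm.lintegral_prod_right'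
  rw [lintegral_lintegral_swap hms.aemeasurable, ← lintegral_const_mul' _ _ (by simp)]
  have hslice : ∀ t ∈ Icc t₀ 1, ENNReal.ofReal (t₀ ^ Module.finrank ℝ E) *
      ∫⁻ w in A, (∫⁻ s in Icc (0 : ℝ) 1, f (t • (P + w + s • d))) ∂μ ≤ ∫⁻ x, f x ∂μ := by
    intro t ht
    have ht' : 0 < t := ht₀.trans_le ht.1
    have hmt : Measurable fun p : E × ℝ => f (t • (P + p.1 + p.2 • d)) := hf.comp (by fun_prop)
    rw [lintegral_lintegral_swap hmt.aemeasurable, ← lintegral_const_mul' _ _ (by simp)]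
    calc _ ≤ ∫⁻ _ in Icc (0 : ℝ) 1, (∫⁻ x, f x ∂μ) := by
          refine lintegral_mono fun s => ?_
          have h := setLIntegral_comp_smul_add_le μ hf ht' (t • (P + s • d)) hA
            MeasurableSet.univ (fun _ _ => mem_univ _)
          rw [setLIntegral_univ] at h
          refine le_trans (mul_le_mul' (ENNReal.ofReal_le_ofReal
            (pow_le_pow_left₀ ht₀.le ht.1 _)) (le_of_eq ?_)) h
          refine lintegral_congr fun w => ?_
          rw [← smul_add]
          congr 2
          abel
      _ = _ := by simp
  calc _ ≤ ∫⁻ _ in Icc t₀ 1, (∫⁻ x, f x ∂μ) := setLIntegral_mono measurable_const hslice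
    _ ≤ _ := by
        rw [setLIntegral_const, Real.volume_Icc]
        exact mul_le_of_le_one_right' (ENNReal.ofReal_le_one.2 (by linarith))

/-- On a ray which meets the complement of `D` there is a visible boundary point. -/
theorem exists_smul_mem_visibleBoundary {n : ℕ} {D : Set (EuclideanSpace ℝ (Fin n))}
    (hD : IsOpen D) {Y : EuclideanSpace ℝ (Fin n)} (hY : Y ∉ D) {a : ℝ} (ha : 0 ≤ a)
    (haD : ∀ t ∈ Icc 0 a, t • Y ∈ D) :
    ∃ τ, a ≤ τ ∧ τ ≤ 1 ∧ τ • Y ∈ visibleBoundary D := by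
  set S : Set ℝ := Icc 0 1 ∩ (fun t : ℝ => t • Y) ⁻¹' Dᶜ with hS
  have hScl : IsCompact S :=
    isCompact_Icc.inter_right (hD.isClosed_compl.preimage (by fun_prop))
  have hSne : S.Nonempty := ⟨1, ⟨zero_le_one, le_rfl⟩, by simpa using hY⟩
  obtain ⟨τ, hτS, hτmin⟩ := hScl.exists_isLeast hSne
  have hlt : ∀ t ∈ Ico 0 τ, t • Y ∈ D := fun t ht => by
    by_contra hc
    exact absurd (hτmin ⟨⟨ht.1, ht.2.le.trans hτS.1.2⟩, hc⟩) (not_le.2 ht.2)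
  have haτ : a < τ := by
    by_contra hc
    exact hτS.2 (haD τ ⟨hτS.1.1, not_lt.1 hc⟩)
  have hτpos : 0 < τ := ha.trans_lt haτ
  have hvis : ∀ s ∈ Ico (0 : ℝ) 1, s • τ • Y ∈ D := fun s hs => by
    rw [smul_smul]
    exact hlt _ ⟨mul_nonneg hs.1 hτpos.le, mul_lt_of_lt_one_left hτpos hs.2⟩
  refine ⟨τ, haτ.le, hτS.1.2, ?_, hvis⟩
  rw [hD.frontier_eq]
  refine ⟨?_, hτS.2⟩
  have hcont : Continuous fun s : ℝ => s • τ • Y := by fun_prop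
  have h1 : (1 : ℝ) ∈ closure (Ico (0 : ℝ) 1) := by
    rw [closure_Ico zero_ne_one]; exact ⟨zero_le_one, le_rfl⟩
  have := map_mem_closure hcont h1 hvis
  simpa using this

/-- If the segment from `P` to `P + d` leaves the open set `D`, it does so at a first parameter `σ`. -/
theorem exists_first_exit {E : Type*} [NormedAddCommGroup E] [NormedSpace ℝ E] {D : Set E}
    (hD : IsOpen D) {P d : E} {s₀ : ℝ} (hs₀ : ∀ s ∈ Icc 0 s₀, P + s • d ∈ D)
    (hseg : ¬ segment ℝ P (P + d) ⊆ D) :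
    ∃ σ, s₀ ≤ σ ∧ σ ≤ 1 ∧ P + σ • d ∉ D ∧ ∀ s ∈ Ico 0 σ, P + s • d ∈ D := by
  set S : Set ℝ := Icc 0 1 ∩ (fun s : ℝ => P + s • d) ⁻¹' Dᶜ with hS
  have hScl : IsCompact S :=
    isCompact_Icc.inter_right (hD.isClosed_compl.preimage (by fun_prop))
  have hSne : S.Nonempty := by
    obtain ⟨y, hy, hyD⟩ := not_subset.1 hseg
    rw [segment_eq_image'] at hy
    obtain ⟨s, hs, rfl⟩ := hy
    exact ⟨s, hs, by simpa using hyD⟩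
  obtain ⟨σ, hσS, hσmin⟩ := hScl.exists_isLeast hSne
  refine ⟨σ, ?_, hσS.1.2, hσS.2, fun s hs => ?_⟩
  · by_contra hc
    exact hσS.2 (hs₀ σ ⟨hσS.1.1, (not_le.1 hc).le⟩)
  · by_contra hc
    exact absurd (hσmin ⟨⟨hs.1, hs.2.le.trans hσS.1.2⟩, hc⟩) (not_le.2 hs.2)

/-- The curve joining the base point `t₀ • (P + b • d)` of a fan to its apex
`τ • (P + σ • d)`, affine in the fan coordinates `(t, s) ↦ t • (P + s • d)`. -/
def fanCurve {n : ℕ} (P d : EuclideanSpace ℝ (Fin n)) (t₀ τ b σ : ℝ) (u : ℝ) :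
    EuclideanSpace ℝ (Fin n) :=
  (t₀ + u * (τ - t₀)) • (P + ((1 - u) * b + u * σ) • d)

theorem fanCurve_mem_starCurves {n : ℕ} {D : Set (EuclideanSpace ℝ (Fin n))}
    (hstar : ∀ x ∈ D, segment ℝ (0 : EuclideanSpace ℝ (Fin n)) x ⊆ D) {ε : ℝ}
    {P d : EuclideanSpace ℝ (Fin n)} {t₀ τ b σ : ℝ} (ht₀ : 0 ≤ t₀) (hτ : t₀ ≤ τ) (hτ1 : τ ≤ 1)
    (hb : 0 ≤ b) (hbσ : b < σ) (hbase : t₀ • (P + b • d) ∈ closedBall 0 ε)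
    (hapex : τ • (P + σ • d) ∈ visibleBoundary D) (hline : ∀ s ∈ Ico 0 σ, P + s • d ∈ D) :
    fanCurve P d t₀ τ b σ ∈ starCurves D ε := by
  have hsmooth : ContDiff ℝ 1 (fanCurve P d t₀ τ b σ) := by unfold fanCurve; fun_prop
  refine ⟨⟨hsmooth.continuous.continuousOn, ∅, fun t _ _ =>
    ⟨hsmooth.differentiable one_ne_zero t, (hsmooth.continuous_deriv le_rfl).continuousAt⟩⟩,
    by simpa [fanCurve] using hbase, by simpa [fanCurve] using hapex, fun u hu => ?_⟩
  have h1 : 0 < 1 - u := by linarith [hu.2]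
  have hs : (1 - u) * b + u * σ ∈ Ico 0 σ :=
    ⟨add_nonneg (mul_nonneg h1.le hb) (mul_nonneg hu.1 (by linarith)), by nlinarith⟩
  refine hstar _ (hline _ hs) ?_
  rw [segment_eq_image']
  refine ⟨t₀ + u * (τ - t₀), ⟨add_nonneg ht₀ (mul_nonneg hu.1 (by linarith)), ?_⟩, ?_⟩
  · nlinarith [hu.1, hu.2]
  · simp [fanCurve]

theorem norm_deriv_fanCurve_le {n : ℕ} {P d : EuclideanSpace ℝ (Fin n)} {t₀ τ b σ u : ℝ}
    (ht₀ : 0 ≤ t₀) (hτ : t₀ ≤ τ) (hτ1 : τ ≤ 1) (hb : 0 ≤ b) (hbσ : b ≤ σ) (hσ1 : σ ≤ 1)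
    (hu : u ∈ Icc (0 : ℝ) 1) :
    ‖deriv (fanCurve P d t₀ τ b σ) u‖ ≤ ‖P‖ + 2 * ‖d‖ := by
  have h1 : HasDerivAt (fun u : ℝ => t₀ + u * (τ - t₀)) (τ - t₀) u := by
    simpa using ((hasDerivAt_id u).mul_const (τ - t₀)).const_add t₀
  have h2 : HasDerivAt (fun u : ℝ => (1 - u) * b + u * σ) (σ - b) u :=
    ((((hasDerivAt_id u).const_sub 1).mul_const b).add
      ((hasDerivAt_id u).mul_const σ)).congr_deriv (by ring)
  have h3 := h1.smul ((h2.smul_const d).const_add P)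
  have hderiv : deriv (fanCurve P d t₀ τ b σ) u = (t₀ + u * (τ - t₀)) • (σ - b) • d +
      (τ - t₀) • (P + ((1 - u) * b + u * σ) • d) := h3.deriv
  have hu1 : 0 ≤ 1 - u := by linarith [hu.2]
  have hs0 : 0 ≤ (1 - u) * b + u * σ :=
    add_nonneg (mul_nonneg hu1 hb) (mul_nonneg hu.1 (by linarith))
  have hs1 : (1 - u) * b + u * σ ≤ 1 := by nlinarith [hu.1]
  have ht : 0 ≤ t₀ + u * (τ - t₀) := add_nonneg ht₀ (mul_nonneg hu.1 (by linarith))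
  have ht1 : t₀ + u * (τ - t₀) ≤ 1 := by nlinarith [hu.1, hu.2]
  have hτ0 : 0 ≤ τ - t₀ := by linarith
  have hσ0 : 0 ≤ σ - b := by linarith
  have hd := norm_nonneg d
  rw [hderiv]
  calc _ ≤ (t₀ + u * (τ - t₀)) * ((σ - b) * ‖d‖) +
        (τ - t₀) * (‖P‖ + ((1 - u) * b + u * σ) * ‖d‖) := by
        refine (norm_add_le _ _).trans (add_le_add ?_ ?_)
        · rw [norm_smul, norm_smul, Real.norm_of_nonneg ht, Real.norm_of_nonneg hσ0]
        · rw [norm_smul, Real.norm_of_nonneg hτ0]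
          gcongr
          refine (norm_add_le _ _).trans_eq ?_
          rw [norm_smul, Real.norm_of_nonneg hs0]
    _ ≤ 1 * (1 * ‖d‖) + 1 * (‖P‖ + 1 * ‖d‖) := by
        gcongr
        · linarith
        · linarith
    _ = _ := by ring

/-- If the modulus of `starCurves D ε` vanishes, then every segment starting in `D` has arbitrarily
small translates contained in `D`. -/
theorem exists_translate_segment_subset {n : ℕ} (hn : 3 ≤ n)
    {D : Set (EuclideanSpace ℝ (Fin n))} (hD : IsOpen D)
    (hstar : ∀ x ∈ D, segment ℝ (0 : EuclideanSpace ℝ (Fin n)) x ⊆ D) {ε : ℝ} (hε : 0 < ε)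
    (hball : closedBall (0 : EuclideanSpace ℝ (Fin n)) ε ⊆ D)
    (hmod : conformalModulus n (starCurves D ε) = 0) {P : EuclideanSpace ℝ (Fin n)}
    (hP : P ∈ D) (Q : EuclideanSpace ℝ (Fin n)) {δ : ℝ} (hδ : 0 < δ) :
    ∃ w, ‖w‖ < δ ∧ segment ℝ (P + w) (Q + w) ⊆ D := by
  by_contra! hcon
  set d := Q - P with hd
  obtain ⟨r, hr, hrD⟩ := Metric.isOpen_iff.1 hD P hP
  set η := min δ (r / 2) with hη
  have hηpos : 0 < η := by positivity
  obtain ⟨s₀, hs₀, hs₀r⟩ : ∃ s₀ : ℝ, 0 < s₀ ∧ s₀ * ‖d‖ < r / 2 := by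
    refine ⟨r / (2 * (‖d‖ + 1)), by positivity, ?_⟩
    rw [div_mul_eq_mul_div, div_lt_div_iff₀ (by positivity) two_pos]
    nlinarith [norm_nonneg d]
  set M := ‖P‖ + η + ‖d‖ with hM
  have hMpos : 0 < M := by positivity
  set t₀ := ε / (2 * M) with ht₀def
  have ht₀ : 0 < t₀ := by positivity
  have ht₀M : 2 * t₀ * M = ε := by rw [ht₀def]; field_simp
  obtain ⟨c, hc, hfan⟩ := exists_pos_le_lintegral_of_segments hn ht₀ (s₀ := s₀ / 2)
    (half_pos hs₀) (C := ‖P‖ + η + 2 * ‖d‖) (by positivity)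
  have hvol : 0 < volume (ball (0 : EuclideanSpace ℝ (Fin n)) η) := measure_ball_pos _ _ hηpos
  have hκ : 0 < ENNReal.ofReal (t₀ ^ n) *
      (ENNReal.ofReal c * volume (ball (0 : EuclideanSpace ℝ (Fin n)) η)) :=
    ENNReal.mul_pos (by positivity) (ENNReal.mul_pos (by positivity) hvol.ne').ne'
  rw [← hmod, conformalModulus] at hκ
  simp only [iInf_lt_iff] at hκ
  obtain ⟨ρ, hρ, hadm, hlt⟩ := hκ
  refine absurd hlt (not_lt.2 ?_)
  have hfanle := lintegral_fan_le volume (hρ.pow_const n) ht₀ P d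
    (A := ball (0 : EuclideanSpace ℝ (Fin n)) η) measurableSet_ball
  rw [finrank_euclideanSpace_fin] at hfanle
  refine le_trans ?_ hfanle
  gcongr
  rw [← setLIntegral_const]
  refine setLIntegral_mono' measurableSet_ball fun w hw => ?_
  rw [mem_ball_zero_iff] at hw
  have hline₀ : ∀ s ∈ Icc 0 s₀, P + w + s • d ∈ D := fun s hs => by
    refine hrD ?_
    rw [mem_ball_iff_norm, show P + w + s • d - P = w + s • d by abel]
    calc ‖w + s • d‖ ≤ ‖w‖ + s * ‖d‖ := by
          refine (norm_add_le _ _).trans_eq ?_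
          rw [norm_smul, Real.norm_of_nonneg hs.1]
      _ < r / 2 + r / 2 := by
          have h1 := hw.trans_le (min_le_right δ (r / 2))
          have h2 := mul_le_mul_of_nonneg_right hs.2 (norm_nonneg d)
          linarith
      _ = r := by ring
  have hleave : ¬ segment ℝ (P + w) (P + w + d) ⊆ D := by
    rw [show P + w + d = Q + w by rw [hd]; abel]
    exact hcon w (hw.trans_le (min_le_left _ _))
  obtain ⟨σ, hσ, hσ1, hσD, hline⟩ := exists_first_exit hD hline₀ hleave
  have hnorm : ∀ s ∈ Icc (0 : ℝ) 1, ‖P + w + s • d‖ ≤ M := fun s hs => by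
    refine (norm_add₃_le).trans ?_
    rw [norm_smul, Real.norm_of_nonneg hs.1]
    have := mul_le_mul_of_nonneg_right hs.2 (norm_nonneg d)
    linarith
  have hsmall : ∀ t ∈ Icc 0 (2 * t₀), ∀ s ∈ Icc (0 : ℝ) 1,
      t • (P + w + s • d) ∈ closedBall (0 : EuclideanSpace ℝ (Fin n)) ε := fun t ht s hs => by
    rw [mem_closedBall_zero_iff, norm_smul, Real.norm_of_nonneg ht.1, ← ht₀M]
    exact mul_le_mul ht.2 (hnorm s hs) (norm_nonneg _) (by positivity)
  have hσ0 : 0 ≤ σ := hs₀.le.trans hσ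
  obtain ⟨τ, hτ, hτ1, hapex⟩ := exists_smul_mem_visibleBoundary hD hσD (a := 2 * t₀)
    (by positivity) (fun t ht => hball (hsmall t ht σ ⟨hσ0, hσ1⟩))
  refine hfan (fun t s => ρ (t • (P + w + s • d))) (hρ.comp (by fun_prop)) σ τ (by linarith) hσ1
    hτ hτ1 fun b hb => ?_
  have hbσ : b < σ := by linarith [hb.2]
  have hcurve := fanCurve_mem_starCurves hstar ht₀.le (by linarith) hτ1 hb.1 hbσ
    (hsmall t₀ ⟨ht₀.le, by linarith⟩ b ⟨hb.1, by linarith⟩) hapex hline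
  refine (hadm _ hcurve).trans (setLIntegral_mono' measurableSet_Icc fun u hu => ?_)
  refine mul_le_mul' le_rfl (ENNReal.ofReal_le_ofReal ?_)
  refine (norm_deriv_fanCurve_le ht₀.le (by linarith) hτ1 hb.1 hbσ.le hσ1 hu).trans ?_
  linarith [norm_add_le P w]

/-- Star lemma, part (ii), Euclidean case: if `n ≥ 3` and `mod_n Γ_ε = 0`,
then `∂D` does not locally divide `ℝⁿ`: every boundary point has arbitrarily
small neighborhoods `V` with `V \ ∂D` connected. -/
theorem star_lemma_ii (n : ℕ) (hn : 3 ≤ n)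
    (D : Set (EuclideanSpace ℝ (Fin n))) (hD : IsOpen D)
    (hDconn : IsConnected D) (hDne : D ≠ Set.univ)
    (h0 : (0 : EuclideanSpace ℝ (Fin n)) ∈ D)
    (hstar : ∀ x ∈ D, segment ℝ (0 : EuclideanSpace ℝ (Fin n)) x ⊆ D)
    (ε : ℝ) (hε : 0 < ε)
    (hball : closedBall (0 : EuclideanSpace ℝ (Fin n)) ε ⊆ D)
    (hmod : conformalModulus n (starCurves D ε) = 0) :
    ∀ x ∈ frontier D, ∀ U ∈ nhds x, ∃ V ∈ nhds x, V ⊆ U ∧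
      IsConnected (V \ frontier D) := by
  have htrans := fun {P} (hP : P ∈ D) (Q : EuclideanSpace ℝ (Fin n)) {δ : ℝ} (hδ : 0 < δ) =>
    exists_translate_segment_subset hn hD hstar hε hball hmod hP Q hδ
  have hdense : Dense D := fun Q => by
    rw [Metric.mem_closure_iff]
    intro δ hδ
    obtain ⟨w, hw, hseg⟩ := htrans h0 Q hδ
    exact ⟨Q + w, hseg (right_mem_segment ℝ _ _), by simpa [dist_eq_norm] using hw⟩
  have hfr : frontier D = Dᶜ := by
    rw [hD.frontier_eq, hdense.closure_eq, compl_eq_univ_sdiff]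
  intro x _ U hU
  obtain ⟨r, hr, hrU⟩ := Metric.mem_nhds_iff.1 hU
  refine ⟨ball x r, ball_mem_nhds x hr, hrU, ?_⟩
  rw [hfr, sdiff_compl]
  have hopen : IsOpen (ball x r ∩ D) := isOpen_ball.inter hD
  refine IsPathConnected.isConnected (isPathConnected_iff.2 ⟨?_, fun P hP Q hQ => ?_⟩)
  · exact hdense.inter_open_nonempty _ isOpen_ball ⟨x, mem_ball_self hr⟩
  obtain ⟨δ₁, hδ₁, hPδ⟩ := Metric.isOpen_iff.1 hopen P hP
  obtain ⟨δ₂, hδ₂, hQδ⟩ := Metric.isOpen_iff.1 hopen Q hQ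
  obtain ⟨w, hw, hseg⟩ := htrans hP.2 Q (lt_min hδ₁ hδ₂)
  have hPw : P + w ∈ ball P δ₁ := by
    simpa [mem_ball_iff_norm] using hw.trans_le (min_le_left _ _)
  have hQw : Q + w ∈ ball Q δ₂ := by
    simpa [mem_ball_iff_norm] using hw.trans_le (min_le_right _ _)
  have hPQ : segment ℝ (P + w) (Q + w) ⊆ ball x r ∩ D :=
    subset_inter ((convex_ball x r).segment_subset (hPδ hPw).1 (hQδ hQw).1) hseg
  have hPP : segment ℝ P (P + w) ⊆ ball x r ∩ D :=
    ((convex_ball P δ₁).segment_subset (mem_ball_self hδ₁) hPw).trans hPδ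
  have hQQ : segment ℝ (Q + w) Q ⊆ ball x r ∩ D :=
    ((convex_ball Q δ₂).segment_subset hQw (mem_ball_self hδ₂)).trans hQδ
  exact ((JoinedIn.of_segment_subset hPP).trans (JoinedIn.of_segment_subset hPQ)).trans
    (JoinedIn.of_segment_subset hQQ)
end

section
/- Capacity equals modulus for spherical rings: let n ≥ 2 and 0 < a < b, and let Γ^b_a be the family of all piecewise C¹ curves γ : [0,1] → ℝⁿ with γ(0) ∈ sphere(0,a), γ(1) ∈ sphere(0,b), and γ((0,1)) contained in the open ring B(0,b) \ closedBall(0,a). Then cap_n(closedBall(0,a), B(0,b)) = mod_n Γ^b_a. -/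
open MeasureTheory Metric Set
open scoped ENNReal

/-- The `p`-capacity of a compact set `C` relative to an open set `D ⊆ ℝⁿ`:
the infimum of `∫_D ‖∇u‖^p` over smooth nonnegative `u` with compact support
contained in `D` that are `≡ 1` on a neighborhood of `C`. -/
noncomputable def pCapacity (n : ℕ) (p : ℝ)
    (C D : Set (EuclideanSpace ℝ (Fin n))) : ℝ :=
  sInf { I : ℝ | ∃ u : EuclideanSpace ℝ (Fin n) → ℝ,
    ContDiff ℝ (⊤ : ℕ∞) u ∧ HasCompactSupport u ∧ tsupport u ⊆ D ∧
    (∀ x, 0 ≤ u x) ∧ (∃ V, IsOpen V ∧ C ⊆ V ∧ ∀ x ∈ V, u x = 1) ∧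
    I = ∫ x in D, ‖fderiv ℝ u x‖ ^ p }

/-- The family `Γ^b_a` of piecewise `C¹` curves joining the two boundary
spheres of the spherical ring `B(0,b) \ closedBall(0,a)` within the open
ring. -/
def ringCurves (n : ℕ) (a b : ℝ) : Set (ℝ → EuclideanSpace ℝ (Fin n)) :=
  {γ | IsPiecewiseC1 γ ∧ γ 0 ∈ sphere (0 : EuclideanSpace ℝ (Fin n)) a ∧
    γ 1 ∈ sphere (0 : EuclideanSpace ℝ (Fin n)) b ∧
    ∀ t ∈ Set.Ioo (0 : ℝ) 1,
      γ t ∈ ball (0 : EuclideanSpace ℝ (Fin n)) b \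
        closedBall (0 : EuclideanSpace ℝ (Fin n)) a}

open scoped ContDiff in
/-- A smooth cutoff on the line descending from `1` to `0` inside `(p, q)`, with slope at most `K`. -/
theorem exists_smooth_cutoff_deriv_le {p q K : ℝ} (hpq : p < q) (hK : 1 / (q - p) < K) :
    ∃ ψ : ℝ → ℝ, ∃ δ > 0, ContDiff ℝ ∞ ψ ∧ (∀ s ≤ p + δ, ψ s = 1) ∧ (∀ s, q - δ ≤ s → ψ s = 0) ∧
      (∀ s, 0 ≤ ψ s) ∧ ∀ s, |deriv ψ s| ≤ K := by
  have hL : 0 < q - p := sub_pos.2 hpq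
  have hK0 : 0 < K := lt_trans (by positivity) hK
  have hKL : 1 / K < q - p := by
    rw [div_lt_iff₀ hL] at hK
    rw [div_lt_iff₀ hK0]
    linarith
  have hK1 : 0 < 1 / K := by positivity
  obtain ⟨R, hR1, hR2⟩ := exists_between hKL
  let f : ContDiffBump ((p + q) / 2 : ℝ) := ⟨1 / K / 2, R / 2, by positivity, by linarith⟩
  set h : ℝ → ℝ := f.normed volume with hh
  have hcont : Continuous h := f.continuous_normed
  have hint : Integrable h := f.integrable_normed
  have hsupp : ∀ s, h s ≠ 0 → (p + q) / 2 - R / 2 < s ∧ s < (p + q) / 2 + R / 2 := by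
    intro s hs
    have : s ∈ ball ((p + q) / 2) f.rOut := by
      rw [← f.support_normed_eq (μ := volume)]; exact hs
    rw [Real.ball_eq_Ioo] at this
    exact this
  have hle : ∀ s, h s ≤ K := by
    intro s
    have h1 := f.normed_le_div_measure_closedBall_rIn volume s
    have h2 : volume.real (closedBall ((p + q) / 2) f.rIn) = 1 / K := by
      rw [measureReal_def, Real.volume_closedBall, ENNReal.toReal_ofReal]
      · change 2 * (1 / K / 2) = _
        ring
      · change 0 ≤ 2 * (1 / K / 2)
        positivity
    rw [h2] at h1
    simpa using h1
  have hderiv : ∀ s, HasDerivAt (fun s => 1 - ∫ t in Iic s, h t) (-h s) s := by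
    intro s
    have h1 : (fun s => 1 - ∫ t in Iic s, h t)
        = fun s => 1 - ((∫ t in p..s, h t) + ∫ t in Iic p, h t) := by
      ext s
      rw [← intervalIntegral.integral_Iic_sub_Iic hint.integrableOn hint.integrableOn]
      ring
    rw [h1]
    exact ((hcont.integral_hasStrictDerivAt p s).hasDerivAt.add_const _).const_sub 1
  refine ⟨fun s => 1 - ∫ t in Iic s, h t, (q - p - R) / 2, by linarith, ?_, ?_, ?_, ?_, ?_⟩
  · rw [contDiff_infty_iff_deriv]
    refine ⟨fun s => (hderiv s).differentiableAt, ?_⟩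
    rw [show deriv (fun s => 1 - ∫ t in Iic s, h t) = fun s => -h s from
      funext fun s => (hderiv s).deriv]
    exact (f.contDiff_normed (n := ⊤)).neg
  · intro s hs
    change 1 - ∫ t in Iic s, h t = 1
    rw [setIntegral_eq_zero_of_forall_eq_zero, sub_zero]
    intro t ht
    by_contra hne
    have := (hsupp t hne).1
    have : t ≤ s := ht
    linarith
  · intro s hs
    have h1 : ∫ t in Iic s, h t = ∫ t, h t := by
      refine setIntegral_eq_integral_of_forall_compl_eq_zero fun t ht => ?_
      by_contra hne
      have := (hsupp t hne).2
      have : s < t := not_le.1 ht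
      linarith
    change 1 - ∫ t in Iic s, h t = 0
    rw [h1, hh, f.integral_normed, sub_self]
  · intro s
    have h1 : ∫ t in Iic s, h t ≤ ∫ t, h t :=
      setIntegral_le_integral hint (Filter.Eventually.of_forall fun t => f.nonneg_normed t)
    rw [hh, f.integral_normed] at h1
    simpa using h1
  · intro s
    rw [(hderiv s).deriv, abs_neg, abs_of_nonneg (f.nonneg_normed s)]
    exact hle s

open scoped ContDiff in
/-- A smooth function equal to `1` near the closed ball of radius `a`, supported in the ball of
radius `b`, whose gradient is nearly that of the extremal logarithmic profile. -/
theorem exists_smooth_radial_cutoff {E : Type*} [NormedAddCommGroup E] [InnerProductSpace ℝ E]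
    [FiniteDimensional ℝ E] {a b K : ℝ} (ha : 0 < a) (hab : a < b)
    (hK : 1 / Real.log (b / a) < K) :
    ∃ u : E → ℝ, ContDiff ℝ ∞ u ∧ HasCompactSupport u ∧ tsupport u ⊆ ball 0 b ∧ (∀ x, 0 ≤ u x) ∧
      (∃ V, IsOpen V ∧ closedBall 0 a ⊆ V ∧ ∀ x ∈ V, u x = 1) ∧
      (∀ x, ‖x‖ ≤ a → fderiv ℝ u x = 0) ∧ ∀ x, a < ‖x‖ → ‖fderiv ℝ u x‖ ≤ K / ‖x‖ := by
  have hb : 0 < b := ha.trans hab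
  rw [Real.log_div hb.ne' ha.ne'] at hK
  obtain ⟨ψ, δ, hδ, hψ, hψ1, hψ0, hψn, hψd⟩ :=
    exists_smooth_cutoff_deriv_le (Real.log_lt_log ha hab) hK
  let u : E → ℝ := fun x => if ‖x‖ < a then 1 else ψ (Real.log ‖x‖)
  have ha1 : a < a * Real.exp δ := by
    have := Real.one_lt_exp_iff.2 hδ
    nlinarith
  have hb1 : b * Real.exp (-δ) < b := by
    have : Real.exp (-δ) < 1 := Real.exp_lt_one_iff.2 (by linarith)
    nlinarith
  have hu1 : ∀ x, ‖x‖ < a * Real.exp δ → u x = 1 := by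
    intro x hx
    by_cases h : ‖x‖ < a
    · simp [u, h]
    · simp only [u, h, if_false]
      apply hψ1
      have h0 : 0 < ‖x‖ := ha.trans_le (not_lt.1 h)
      rw [← Real.log_exp δ, ← Real.log_mul ha.ne' (Real.exp_ne_zero _)]
      exact Real.log_le_log h0 hx.le
  have hu0 : ∀ x, b * Real.exp (-δ) ≤ ‖x‖ → u x = 0 := by
    intro x hx
    have hbe : 0 < b * Real.exp (-δ) := by positivity
    have hlog : Real.log b - δ ≤ Real.log ‖x‖ := by
      have := Real.log_le_log hbe hx
      rwa [Real.log_mul hb.ne' (Real.exp_ne_zero _), Real.log_exp, ← sub_eq_add_neg] at this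
    by_cases h : ‖x‖ < a
    · have h3 := Real.log_lt_log (hbe.trans_le hx) h
      have h4 := hψ0 _ hlog
      rw [hψ1 _ (by linarith)] at h4
      norm_num at h4
    · simp only [u, h, if_false]
      exact hψ0 _ hlog
  have hev : ∀ x, a < ‖x‖ → u =ᶠ[nhds x] fun y => ψ (Real.log ‖y‖) := by
    intro x hx
    filter_upwards [continuous_norm.continuousAt.eventually (lt_mem_nhds hx)] with y hy
    simp [u, not_lt.2 hy.le]
  have hev1 : ∀ x, ‖x‖ ≤ a → u =ᶠ[nhds x] fun _ => 1 := by
    intro x hx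
    filter_upwards [continuous_norm.continuousAt.eventually (gt_mem_nhds (hx.trans_lt ha1))]
      with y hy using hu1 y hy
  have hts : tsupport u ⊆ closedBall 0 (b * Real.exp (-δ)) := by
    refine closure_minimal (fun x hx => ?_) isClosed_closedBall
    rw [mem_closedBall_zero_iff]
    by_contra h
    exact hx (hu0 x (not_le.1 h).le)
  refine ⟨u, ?_, ?_, ?_, ?_, ?_, ?_, ?_⟩
  · rw [contDiff_iff_contDiffAt]
    intro x
    rcases le_or_gt ‖x‖ a with hx | hx
    · exact contDiffAt_const.congr_of_eventuallyEq (hev1 x hx)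
    · refine ContDiffAt.congr_of_eventuallyEq ?_ (hev x hx)
      have hx0 : 0 < ‖x‖ := ha.trans hx
      exact hψ.contDiffAt.comp x ((contDiffAt_norm ℝ (norm_pos_iff.1 hx0)).log hx0.ne')
  · exact (isCompact_closedBall _ _).of_isClosed_subset (isClosed_tsupport u) hts
  · exact hts.trans (closedBall_subset_ball hb1)
  · intro x
    by_cases h : ‖x‖ < a
    · simp [u, h]
    · simp [u, h, hψn]
  · exact ⟨ball 0 (a * Real.exp δ), isOpen_ball, closedBall_subset_ball ha1,
      fun x hx => hu1 x (by simpa using hx)⟩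
  · intro x hx
    rw [(hev1 x hx).fderiv_eq, fderiv_fun_const, Pi.zero_apply]
  · intro x hx
    have hx0 : 0 < ‖x‖ := ha.trans hx
    have hn : HasFDerivAt (fun y : E => ‖y‖) (fderiv ℝ (fun y : E => ‖y‖) x) x :=
      ((contDiffAt_norm ℝ (n := 1) (norm_pos_iff.1 hx0)).differentiableAt one_ne_zero).hasFDerivAt
    have hψx : HasDerivAt ψ (deriv ψ (Real.log ‖x‖)) (Real.log ‖x‖) :=
      (hψ.differentiable (by simp) _).hasDerivAt
    have h1 : HasFDerivAt (fun y : E => ψ (Real.log ‖y‖))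
        ((deriv ψ (Real.log ‖x‖) * ‖x‖⁻¹) • fderiv ℝ (fun y : E => ‖y‖) x) x :=
      (hψx.comp ‖x‖ (Real.hasDerivAt_log hx0.ne')).comp_hasFDerivAt x hn
    rw [(hev x hx).fderiv_eq, h1.fderiv, norm_smul, norm_mul, norm_inv, norm_norm, div_eq_mul_inv]
    have h2 : ‖fderiv ℝ (fun y : E => ‖y‖) x‖ ≤ 1 := by
      simpa using norm_fderiv_le_of_lipschitz ℝ (x₀ := x) (lipschitzWith_one_norm (E := E))
    have h3 : ‖deriv ψ (Real.log ‖x‖)‖ ≤ K := hψd _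
    have hK0 : 0 ≤ K := (norm_nonneg _).trans h3
    calc _ ≤ K * ‖x‖⁻¹ * 1 := by gcongr
      _ = _ := mul_one _

/-- Integration in polar coordinates. -/
theorem lintegral_eq_lintegral_toSphere_lintegral_Ioi {E : Type*} [NormedAddCommGroup E]
    [NormedSpace ℝ E] [Nontrivial E] [FiniteDimensional ℝ E] [MeasurableSpace E] [BorelSpace E]
    (μ : Measure E) [μ.IsAddHaarMeasure] {f : E → ℝ≥0∞} (hf : Measurable f) :
    ∫⁻ x, f x ∂μ = ∫⁻ θ : sphere (0 : E) 1, (∫⁻ r in Ioi (0 : ℝ),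
      ENNReal.ofReal (r ^ (Module.finrank ℝ E - 1)) * f (r • (θ : E))) ∂μ.toSphere := by
  have hmeas : Measurable fun p : sphere (0 : E) 1 × Ioi (0 : ℝ) => f ((p.2 : ℝ) • (p.1 : E)) :=
    hf.comp (by fun_prop)
  calc ∫⁻ x, f x ∂μ = ∫⁻ x : ({(0)}ᶜ : Set E), f x ∂(μ.comap (↑)) := by
        rw [lintegral_subtype_comap (measurableSet_singleton _).compl, restrict_compl_singleton]
    _ = ∫⁻ p, f ((p.2 : ℝ) • (p.1 : E))
          ∂μ.toSphere.prod (.volumeIoiPow (Module.finrank ℝ E - 1)) := by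
        rw [← μ.measurePreserving_homeomorphUnitSphereProd.lintegral_comp hmeas]
        refine lintegral_congr fun x => ?_
        have hx : ‖(x : E)‖ ≠ 0 := norm_ne_zero_iff.2 x.2
        simp [smul_smul, hx]
    _ = _ := by
        rw [lintegral_prod _ hmeas.aemeasurable]
        refine lintegral_congr fun θ => ?_
        have hθ : Measurable fun r : Ioi (0 : ℝ) => f ((r : ℝ) • (θ : E)) := hf.comp (by fun_prop)
        rw [Measure.volumeIoiPow, lintegral_withDensity_eq_lintegral_mul _ (by fun_prop) hθ,
          ← lintegral_subtype_comap measurableSet_Ioi]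
        rfl

/-- The tangent line inequality for `x ↦ x ^ n` at `c`. -/
theorem mul_pow_mul_le_pow_add {n : ℕ} (hn : 1 ≤ n) {x c : ℝ} (hx : 0 ≤ x) (hc : 0 < c) :
    n * c ^ (n - 1) * x ≤ x ^ n + (n - 1) * c ^ n := by
  obtain ⟨m, rfl⟩ := Nat.exists_eq_add_of_le' hn
  have hxc : 0 ≤ x / c := by positivity
  have h := one_add_mul_le_pow (a := x / c - 1) (by linarith) (m + 1)
  rw [add_sub_cancel, div_pow, le_div_iff₀ (by positivity)] at h
  have h2 : (1 + ((m + 1 : ℕ) : ℝ) * (x / c - 1)) * c ^ (m + 1)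
      = (m + 1 : ℕ) * c ^ m * x - m * c ^ (m + 1) := by
    field_simp
    push_cast
    ring
  rw [h2] at h
  simp only [Nat.add_sub_cancel]
  push_cast at h ⊢
  linarith

theorem lintegral_Ioo_ofReal_inv {a b : ℝ} (ha : 0 < a) (hab : a < b) :
    ∫⁻ r in Ioo a b, ENNReal.ofReal r⁻¹ = ENNReal.ofReal (Real.log (b / a)) := by
  rw [Measure.restrict_congr_set Ioo_ae_eq_Ioc, ← integral_inv_of_pos ha (ha.trans hab),
    intervalIntegral.integral_of_le hab.le, ofReal_integral_eq_lintegral_ofReal]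
  · refine ((continuousOn_inv₀.mono fun x hx => ?_).integrableOn_Icc).mono_set Ioc_subset_Icc_self
    exact (ha.trans_le hx.1).ne'
  · filter_upwards [ae_restrict_mem measurableSet_Ioc] with y hy
    exact inv_nonneg.2 (ha.trans hy.1).le

/-- The weighted one-dimensional inequality behind the modulus of a ring. -/
theorem ofReal_le_lintegral_Ioo_pow {n : ℕ} (hn : 1 ≤ n) {a b : ℝ} (ha : 0 < a) (hab : a < b)
    {g : ℝ → ℝ≥0∞} (hg1 : 1 ≤ ∫⁻ r in Ioo a b, g r) :
    ENNReal.ofReal ((1 / Real.log (b / a)) ^ (n - 1)) ≤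
      ∫⁻ r in Ioo a b, ENNReal.ofReal (r ^ (n - 1)) * g r ^ n := by
  have hL : 0 < Real.log (b / a) := Real.log_pos ((one_lt_div ha).2 hab)
  set c := 1 / Real.log (b / a) with hc
  have hc0 : 0 < c := by positivity
  have hn1 : (0 : ℝ) ≤ n - 1 := by
    have : (1 : ℝ) ≤ n := by exact_mod_cast hn
    linarith
  have hpt : ∀ r ∈ Ioo a b, ENNReal.ofReal (n * c ^ (n - 1)) * g r ≤
      ENNReal.ofReal (r ^ (n - 1)) * g r ^ n
        + ENNReal.ofReal ((n - 1) * c ^ n) * ENNReal.ofReal r⁻¹ := by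
    intro r hr
    have hr0 : 0 < r := ha.trans hr.1
    rcases eq_or_ne (g r) ⊤ with hg | hg
    · have : ENNReal.ofReal (r ^ (n - 1)) ≠ 0 := by
        rw [Ne, ENNReal.ofReal_eq_zero, not_le]
        positivity
      rw [hg, ENNReal.top_pow (by lia), ENNReal.mul_top this, top_add]
      exact le_top
    · rw [← ENNReal.ofReal_toReal hg]
      set y := (g r).toReal
      have hy : 0 ≤ y := ENNReal.toReal_nonneg
      rw [← ENNReal.ofReal_pow hy, ← ENNReal.ofReal_mul (by positivity),
        ← ENNReal.ofReal_mul (by positivity), ← ENNReal.ofReal_mul (by positivity),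
        ← ENNReal.ofReal_add (by positivity) (by positivity)]
      apply ENNReal.ofReal_le_ofReal
      have h := mul_pow_mul_le_pow_add hn (mul_nonneg hy hr0.le) hc0
      have h2 := mul_le_mul_of_nonneg_right h (inv_nonneg.2 hr0.le)
      have h3 : r ^ n * r⁻¹ = r ^ (n - 1) := by
        rw [← Nat.sub_add_cancel hn, pow_succ]
        simp [hr0.ne']
      calc _ = ↑n * c ^ (n - 1) * (y * r) * r⁻¹ := by field_simp
        _ ≤ _ := h2
        _ = (r ^ n * r⁻¹) * y ^ n + (n - 1) * c ^ n * r⁻¹ := by ring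
        _ = _ := by rw [h3]
  have hcn : c ^ n * Real.log (b / a) = c ^ (n - 1) := by
    rw [← Nat.sub_add_cancel hn, pow_succ, mul_assoc, hc]
    simp [hL.ne']
  have hI : ENNReal.ofReal (n * c ^ (n - 1)) ≤
      (∫⁻ r in Ioo a b, ENNReal.ofReal (r ^ (n - 1)) * g r ^ n)
        + ENNReal.ofReal ((n - 1) * c ^ (n - 1)) := by
    calc ENNReal.ofReal (n * c ^ (n - 1))
        ≤ ENNReal.ofReal (n * c ^ (n - 1)) * ∫⁻ r in Ioo a b, g r := le_mul_of_one_le_right' hg1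
      _ = ∫⁻ r in Ioo a b, ENNReal.ofReal (n * c ^ (n - 1)) * g r :=
        (lintegral_const_mul' _ _ ENNReal.ofReal_ne_top).symm
      _ ≤ ∫⁻ r in Ioo a b, (ENNReal.ofReal (r ^ (n - 1)) * g r ^ n
            + ENNReal.ofReal ((n - 1) * c ^ n) * ENNReal.ofReal r⁻¹) :=
        setLIntegral_mono' measurableSet_Ioo hpt
      _ = _ := by
        rw [lintegral_add_right _ (by fun_prop), lintegral_const_mul' _ _ ENNReal.ofReal_ne_top,
          lintegral_Ioo_ofReal_inv ha hab, ← ENNReal.ofReal_mul (by positivity), mul_assoc, hcn]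
  have hsplit : (n : ℝ) * c ^ (n - 1) = c ^ (n - 1) + (n - 1) * c ^ (n - 1) := by ring
  rw [hsplit, ENNReal.ofReal_add (by positivity) (by positivity)] at hI
  exact (ENNReal.add_le_add_iff_right ENNReal.ofReal_ne_top).1 hI

theorem segment_mem_ringCurves {n : ℕ} {a b : ℝ} (ha : 0 < a) (hab : a < b)
    {θ : EuclideanSpace ℝ (Fin n)} (hθ : ‖θ‖ = 1) :
    (fun t : ℝ => (a + t * (b - a)) • θ) ∈ ringCurves n a b := by
  have hnorm : ∀ t : ℝ, 0 ≤ t → ‖(a + t * (b - a)) • θ‖ = a + t * (b - a) := by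
    intro t ht
    rw [norm_smul, hθ, mul_one, Real.norm_of_nonneg]
    nlinarith
  have hsm : ContDiff ℝ 1 fun t : ℝ => (a + t * (b - a)) • θ := by fun_prop
  refine ⟨⟨hsm.continuous.continuousOn, ∅, fun t _ _ => ⟨hsm.differentiable one_ne_zero t,
    (hsm.continuous_deriv le_rfl).continuousAt⟩⟩, ?_, ?_, fun t ht => ⟨?_, ?_⟩⟩
  · rw [mem_sphere_zero_iff_norm, hnorm 0 le_rfl]; ring
  · rw [mem_sphere_zero_iff_norm, hnorm 1 zero_le_one]; ring
  · rw [mem_ball_zero_iff, hnorm t ht.1.le]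
    nlinarith [ht.2]
  · rw [mem_closedBall_zero_iff, hnorm t ht.1.le, not_le]
    nlinarith [ht.1]

theorem lineLIntegral_segment {n : ℕ} {a b : ℝ} (hab : a < b)
    (ρ : EuclideanSpace ℝ (Fin n) → ℝ≥0∞) {θ : EuclideanSpace ℝ (Fin n)} (hθ : ‖θ‖ = 1) :
    lineLIntegral ρ (fun t : ℝ => (a + t * (b - a)) • θ) = ∫⁻ r in Ioo a b, ρ (r • θ) := by
  have hba : 0 < b - a := sub_pos.2 hab
  have hd : ∀ t, HasDerivAt (fun t : ℝ => a + t * (b - a)) (b - a) t := fun t => by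
    simpa using ((hasDerivAt_id t).mul_const (b - a)).const_add a
  have himg : (fun t : ℝ => a + t * (b - a)) '' Icc 0 1 = Icc a b := by
    have : (fun t : ℝ => a + t * (b - a)) = fun t => (b - a) * t + a := by ext t; ring
    rw [this, image_affine_Icc' hba]
    simp
  rw [Measure.restrict_congr_set Ioo_ae_eq_Icc, ← himg,
    lintegral_image_eq_lintegral_abs_deriv_mul measurableSet_Icc
      (fun t _ => (hd t).hasDerivWithinAt)
      (fun s _ t _ h => by simpa [hba.ne'] using h), lineLIntegral]
  refine lintegral_congr fun t => ?_
  rw [((hd t).smul_const θ).deriv, norm_smul, hθ, mul_one, Real.norm_eq_abs, mul_comm]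

theorem le_lintegral_pow_of_admissible {n : ℕ} (hn : 1 ≤ n) {a b : ℝ} (ha : 0 < a) (hab : a < b)
    {ρ : EuclideanSpace ℝ (Fin n) → ℝ≥0∞} (hρ : Measurable ρ)
    (hadm : ∀ γ ∈ ringCurves n a b, 1 ≤ lineLIntegral ρ γ) :
    ENNReal.ofReal ((1 / Real.log (b / a)) ^ (n - 1)) *
      (volume : Measure (EuclideanSpace ℝ (Fin n))).toSphere univ ≤ ∫⁻ x, ρ x ^ n := by
  have : NeZero n := ⟨by lia⟩
  rw [lintegral_eq_lintegral_toSphere_lintegral_Ioi volume (hρ.pow_const n), ← lintegral_const]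
  refine lintegral_mono fun θ => ?_
  have hθ : ‖(θ : EuclideanSpace ℝ (Fin n))‖ = 1 := mem_sphere_zero_iff_norm.1 θ.2
  have h1 := hadm _ (segment_mem_ringCurves ha hab hθ)
  rw [lineLIntegral_segment hab ρ hθ] at h1
  refine (ofReal_le_lintegral_Ioo_pow hn ha hab h1).trans ?_
  rw [finrank_euclideanSpace_fin]
  exact lintegral_mono_set fun r hr => ha.trans hr.1

theorem lintegral_ring_ofReal_div_norm_pow {n : ℕ} (hn : 1 ≤ n) {a b K : ℝ} (ha : 0 < a)
    (hab : a < b) (hK : 0 ≤ K) :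
    ∫⁻ x : EuclideanSpace ℝ (Fin n),
        {x | ‖x‖ ∈ Ioo a b}.indicator (fun x => ENNReal.ofReal ((K / ‖x‖) ^ n)) x
      = ENNReal.ofReal (K ^ n * Real.log (b / a)) *
        (volume : Measure (EuclideanSpace ℝ (Fin n))).toSphere univ := by
  have : NeZero n := ⟨by lia⟩
  have hms : MeasurableSet {x : EuclideanSpace ℝ (Fin n) | ‖x‖ ∈ Ioo a b} :=
    measurable_norm measurableSet_Ioo
  rw [lintegral_eq_lintegral_toSphere_lintegral_Ioi volume
    (Measurable.indicator (by fun_prop) hms), ← lintegral_const]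
  refine lintegral_congr fun θ => ?_
  have hθ : ‖(θ : EuclideanSpace ℝ (Fin n))‖ = 1 := mem_sphere_zero_iff_norm.1 θ.2
  rw [finrank_euclideanSpace_fin, ENNReal.ofReal_mul (by positivity),
    ← lintegral_Ioo_ofReal_inv ha hab, ← lintegral_const_mul' _ _ ENNReal.ofReal_ne_top,
    ← lintegral_indicator measurableSet_Ioi, ← lintegral_indicator measurableSet_Ioo]
  refine lintegral_congr fun r => ?_
  by_cases hr0 : 0 < r
  · have hnr : ‖r • (θ : EuclideanSpace ℝ (Fin n))‖ = r := by
      rw [norm_smul, hθ, mul_one, Real.norm_of_nonneg hr0.le]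
    by_cases hr : r ∈ Ioo a b
    · rw [indicator_of_mem (mem_Ioi.2 hr0), indicator_of_mem hr, indicator_of_mem (by simpa [hnr]),
        hnr, ← ENNReal.ofReal_mul (by positivity), ← ENNReal.ofReal_mul (by positivity)]
      congr 1
      rw [div_pow, ← Nat.sub_add_cancel hn, Nat.add_sub_cancel]
      field_simp
      ring
    · rw [indicator_of_mem (mem_Ioi.2 hr0), indicator_of_notMem hr,
        indicator_of_notMem (by simpa [hnr] using hr), mul_zero]
  · rw [indicator_of_notMem (show r ∉ Ioi 0 from hr0), indicator_of_notMem]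
    exact fun h => hr0 (ha.trans h.1)

/-- The gradient of a function dropping from `1` to `0` across the ring is admissible. -/
theorem one_le_lineLIntegral_enorm_fderiv {n : ℕ} {u : EuclideanSpace ℝ (Fin n) → ℝ}
    (hu : Differentiable ℝ u) {γ : ℝ → EuclideanSpace ℝ (Fin n)} (hγ : IsPiecewiseC1 γ)
    (h0 : u (γ 0) = 1) (h1 : u (γ 1) = 0) :
    1 ≤ lineLIntegral (fun x => ‖fderiv ℝ u x‖ₑ) γ := by
  obtain ⟨hc, s, hs⟩ := hγ
  set g : ℝ → ℝ := u ∘ γ with hg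
  have hd : ∀ t ∈ Icc (0 : ℝ) 1 \ s, HasDerivAt g (fderiv ℝ u (γ t) (deriv γ t)) t :=
    fun t ht => (hu (γ t)).hasFDerivAt.comp_hasDerivAt t (hs t ht.1 ht.2).1.hasDerivAt
  have hle : ∫⁻ t in Icc (0 : ℝ) 1, ‖deriv g t‖ₑ ≤
      lineLIntegral (fun x => ‖fderiv ℝ u x‖ₑ) γ := by
    refine lintegral_mono_ae ?_
    filter_upwards [ae_restrict_mem measurableSet_Icc,
      ae_restrict_of_ae (s.finite_toSet.countable.ae_notMem volume)] with t ht hts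
    rw [(hd t ⟨ht, hts⟩).deriv, ofReal_norm]
    exact (fderiv ℝ u (γ t)).le_opENorm _
  by_cases hfin : ∫⁻ t in Icc (0 : ℝ) 1, ‖deriv g t‖ₑ = ⊤
  · rw [hfin, top_le_iff] at hle
    rw [hle]
    exact le_top
  refine le_trans ?_ hle
  have hint : IntegrableOn (deriv g) (Icc 0 1) :=
    ⟨(measurable_deriv g).aestronglyMeasurable, lt_top_iff_ne_top.2 hfin⟩
  have hftc : ∫ t in (0 : ℝ)..1, deriv g t = g 1 - g 0 := by
    refine integral_eq_of_hasDerivAt_off_countable_of_le g _ zero_le_one s.finite_toSet.countable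
      (hu.continuous.comp_continuousOn hc) (fun t ht => ?_) ?_
    · exact (hd t ⟨Ioo_subset_Icc_self ht.1, ht.2⟩).differentiableAt.hasDerivAt
    · rw [intervalIntegrable_iff_integrableOn_Icc_of_le zero_le_one]
      exact hint
  rw [intervalIntegral.integral_of_le zero_le_one, ← integral_Icc_eq_integral_Ioc] at hftc
  have := enorm_integral_le_lintegral_enorm (μ := volume.restrict (Icc (0 : ℝ) 1)) (deriv g)
  rw [hftc] at this
  simpa [hg, h0, h1] using this

theorem conformalModulus_ringCurves_le {n : ℕ} (hn : 1 ≤ n) {a b : ℝ}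
    {u : EuclideanSpace ℝ (Fin n) → ℝ} (hu : ContDiff ℝ (⊤ : ℕ∞) u) (hcs : HasCompactSupport u)
    (hts : tsupport u ⊆ ball 0 b) (hone : ∀ x ∈ closedBall 0 a, u x = 1) :
    conformalModulus n (ringCurves n a b) ≤
      ENNReal.ofReal (∫ x in ball 0 b, ‖fderiv ℝ u x‖ ^ (n : ℝ)) := by
  have hcont : Continuous (fderiv ℝ u) := hu.continuous_fderiv (by simp)
  have hpow : ∀ x, ‖fderiv ℝ u x‖ ^ (n : ℝ) = ‖fderiv ℝ u x‖ ^ n := fun x => Real.rpow_natCast _ _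
  simp only [hpow]
  have hint : Integrable fun x => ‖fderiv ℝ u x‖ ^ n := by
    refine (hcont.norm.pow n).integrable_of_hasCompactSupport ?_
    refine (hcs.fderiv ℝ).mono fun x hx => ?_
    simp only [Function.mem_support] at hx ⊢
    rintro h
    simp [h, show n ≠ 0 by lia] at hx
  rw [ofReal_integral_eq_lintegral_ofReal hint.integrableOn
    (Filter.Eventually.of_forall fun x => by positivity)]
  have hsupp : (Function.support fun x => ENNReal.ofReal (‖fderiv ℝ u x‖ ^ n)) ⊆ ball 0 b := by
    intro x hx
    apply hts
    apply support_fderiv_subset ℝ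
    intro h
    exact hx (by simp only [h, norm_zero, zero_pow (show n ≠ 0 by lia), ENNReal.ofReal_zero])
  rw [setLIntegral_eq_of_support_subset hsupp]
  refine (iInf₂_le (fun x => ‖fderiv ℝ u x‖ₑ) hcont.enorm.measurable).trans
    ((iInf_le _ ?_).trans (le_of_eq ?_))
  · rintro γ ⟨hγ, h0, h1, -⟩
    refine one_le_lineLIntegral_enorm_fderiv (hu.differentiable (by simp)) hγ
      (hone _ (sphere_subset_closedBall h0)) ?_
    refine image_eq_zero_of_notMem_tsupport fun h => ?_
    have h2 := hts h
    rw [mem_ball_zero_iff, mem_sphere_zero_iff_norm.1 h1] at h2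
    exact lt_irrefl _ h2
  · simp only [ENNReal.ofReal_pow (norm_nonneg _), ofReal_norm]

/-- The capacity competitors built from logarithmic profiles of slope at most `K`. -/
theorem pCapacity_ring_le {n : ℕ} (hn : 1 ≤ n) {a b K : ℝ} (ha : 0 < a) (hab : a < b)
    (hK : 1 / Real.log (b / a) < K) :
    ENNReal.ofReal (pCapacity n n (closedBall (0 : EuclideanSpace ℝ (Fin n)) a)
        (ball (0 : EuclideanSpace ℝ (Fin n)) b)) ≤
      ENNReal.ofReal (K ^ n * Real.log (b / a)) *
        (volume : Measure (EuclideanSpace ℝ (Fin n))).toSphere univ := by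
  have hL : 0 < Real.log (b / a) := Real.log_pos ((one_lt_div ha).2 hab)
  have hK0 : 0 < K := lt_trans (by positivity) hK
  obtain ⟨u, hu, hcs, hts, hnn, hone, hd0, hd⟩ :=
    exists_smooth_radial_cutoff (E := EuclideanSpace ℝ (Fin n)) ha hab hK
  have hcont : Continuous (fderiv ℝ u) := hu.continuous_fderiv (by simp)
  have hcap : pCapacity n n (closedBall (0 : EuclideanSpace ℝ (Fin n)) a)
      (ball (0 : EuclideanSpace ℝ (Fin n)) b) ≤ ∫ x in ball 0 b, ‖fderiv ℝ u x‖ ^ (n : ℝ) := by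
    refine csInf_le ⟨0, ?_⟩ ⟨u, hu, hcs, hts, hnn, hone, rfl⟩
    rintro I ⟨v, -, -, -, -, -, rfl⟩
    exact integral_nonneg fun x => by positivity
  refine (ENNReal.ofReal_le_ofReal hcap).trans ?_
  simp only [Real.rpow_natCast]
  rw [integral_eq_lintegral_of_nonneg_ae (Filter.Eventually.of_forall fun x => by positivity)
    (by fun_prop), ← lintegral_ring_ofReal_div_norm_pow hn ha hab hK0.le]
  refine ENNReal.ofReal_toReal_le.trans ?_
  rw [← lintegral_indicator measurableSet_ball]
  refine lintegral_mono fun x => ?_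
  by_cases hxb : x ∈ ball (0 : EuclideanSpace ℝ (Fin n)) b
  · rw [indicator_of_mem hxb]
    rcases le_or_gt ‖x‖ a with hxa | hxa
    · simp [hd0 x hxa, show n ≠ 0 by lia]
    · rw [indicator_of_mem (show x ∈ {x | ‖x‖ ∈ Ioo a b} from ⟨hxa, mem_ball_zero_iff.1 hxb⟩)]
      exact ENNReal.ofReal_le_ofReal (pow_le_pow_left₀ (norm_nonneg _) (hd x hxa) n)
  · rw [indicator_of_notMem hxb]
    exact zero_le

/-- Capacity equals modulus for spherical rings. -/
theorem capacity_eq_modulus (n : ℕ) (hn : 2 ≤ n) (a b : ℝ)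
    (ha : 0 < a) (hab : a < b) :
    ENNReal.ofReal
        (pCapacity n n (closedBall (0 : EuclideanSpace ℝ (Fin n)) a)
          (ball (0 : EuclideanSpace ℝ (Fin n)) b))
      = conformalModulus n (ringCurves n a b) := by
  have hn1 : 1 ≤ n := by lia
  have hL : 0 < Real.log (b / a) := Real.log_pos ((one_lt_div ha).2 hab)
  apply le_antisymm
  · refine le_iInf fun ρ => le_iInf fun hρ => le_iInf fun hadm => ?_
    refine le_trans ?_ (le_lintegral_pow_of_admissible hn1 ha hab hρ hadm)
    have hlim : Filter.Tendsto (fun K : ℝ => ENNReal.ofReal (K ^ n * Real.log (b / a)) *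
          (volume : Measure (EuclideanSpace ℝ (Fin n))).toSphere univ)
        (nhdsWithin (1 / Real.log (b / a)) (Ioi (1 / Real.log (b / a))))
        (nhds (ENNReal.ofReal ((1 / Real.log (b / a)) ^ n * Real.log (b / a)) *
          (volume : Measure (EuclideanSpace ℝ (Fin n))).toSphere univ)) := by
      refine ENNReal.Tendsto.mul_const (ENNReal.tendsto_ofReal ?_) (Or.inr (measure_ne_top _ _))
      exact ((continuous_pow n).mul continuous_const).continuousAt.tendsto.mono_left
        nhdsWithin_le_nhds
    have hcn : (1 / Real.log (b / a)) ^ n * Real.log (b / a)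
        = (1 / Real.log (b / a)) ^ (n - 1) := by
      rw [← Nat.sub_add_cancel hn1, pow_succ, mul_assoc]
      simp [hL.ne']
    rw [hcn] at hlim
    refine ge_of_tendsto hlim ?_
    filter_upwards [self_mem_nhdsWithin] with K hK
    exact pCapacity_ring_le hn1 ha hab hK
  · have hle : ∀ u : EuclideanSpace ℝ (Fin n) → ℝ, ContDiff ℝ (⊤ : ℕ∞) u → HasCompactSupport u →
        tsupport u ⊆ ball 0 b → (∃ V, IsOpen V ∧ closedBall 0 a ⊆ V ∧ ∀ x ∈ V, u x = 1) →
        conformalModulus n (ringCurves n a b) ≤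
          ENNReal.ofReal (∫ x in ball 0 b, ‖fderiv ℝ u x‖ ^ (n : ℝ)) := by
      rintro u hu hcs hts ⟨V, -, hV, hone⟩
      exact conformalModulus_ringCurves_le hn1 hu hcs hts fun x hx => hone x (hV hx)
    obtain ⟨u, hu, hcs, hts, hnn, hone, -⟩ :=
      exists_smooth_radial_cutoff (E := EuclideanSpace ℝ (Fin n)) ha hab (lt_add_one _)
    have hfin : conformalModulus n (ringCurves n a b) ≠ ⊤ :=
      ne_top_of_le_ne_top ENNReal.ofReal_ne_top (hle u hu hcs hts hone)
    rw [← ENNReal.ofReal_toReal hfin]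
    apply ENNReal.ofReal_le_ofReal
    refine le_csInf ⟨_, u, hu, hcs, hts, hnn, hone, rfl⟩ ?_
    rintro I ⟨v, hv, hvcs, hvts, -, hvone, rfl⟩
    refine ENNReal.toReal_le_of_le_ofReal (integral_nonneg fun x => by positivity) ?_
    exact hle v hv hvcs hvts hvone
end
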